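/- arXiv:0710.4861 — 3 statements merged into one kernel-verified Lean document; each statement's English description precedes it below -/
import Mathlib

section
/- Let D ⊂ ℤ² \ {0} satisfy δ(D) = 1, where δ(D) := sup_{H₁,H₂ ≥ 0} card(D ∩ [−H₁,H₁]×[−H₂,H₂]) / ((2H₁+1)(2H₂+1)). If (x_n)_{n∈ℤ²} is a family of real numbers such that for every d ∈ D the family (x_{n+d} − x_n)_{n∈ℕ²} is uniformly distributed mod 1, then the family (x_n)_{n∈ℕ²} is uniformly distributed mod 1. -/
open Filter Finset

/-- The average of `f ∘ x` over the box `1 ≤ n₁ ≤ N₁`, `1 ≤ n₂ ≤ N₂`. -/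
noncomputable def udAvg (x : ℤ × ℤ → ℝ) (f : ℝ → ℂ) (N : ℕ × ℕ) : ℂ :=
  (1 / ((N.1 : ℂ) * (N.2 : ℂ))) *
    ∑ n ∈ Finset.Icc 1 N.1 ×ˢ Finset.Icc 1 N.2, f (x ((n.1 : ℤ), (n.2 : ℤ)))

/-- The family `(x_n)_{n∈ℕ²}` is uniformly distributed mod 1. -/
def IsUD2 (x : ℤ × ℤ → ℝ) : Prop :=
  ∀ f : ℝ → ℂ, Continuous f → (∀ t, f (t + 1) = f t) →
    Tendsto (udAvg x f) atTop (nhds (∫ t in (0:ℝ)..1, f t))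

open scoped ComplexConjugate

/-- The average of `g` over the box `1 ≤ n₁ ≤ N₁`, `1 ≤ n₂ ≤ N₂`. -/
noncomputable def boxAvg (g : ℤ × ℤ → ℂ) (N : ℕ × ℕ) : ℂ :=
  (1 / ((N.1 : ℂ) * (N.2 : ℂ))) *
    ∑ n ∈ Finset.Icc 1 N.1 ×ˢ Finset.Icc 1 N.2, g ((n.1 : ℤ), (n.2 : ℤ))

@[simp]
lemma boxAvg_zero : boxAvg (fun _ => 0) = fun _ => 0 := by
  ext N; simp [boxAvg]

lemma boxAvg_add (g g' : ℤ × ℤ → ℂ) (N : ℕ × ℕ) :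
    boxAvg (fun n => g n + g' n) N = boxAvg g N + boxAvg g' N := by
  simp [boxAvg, sum_add_distrib, mul_add]

lemma boxAvg_sub (g g' : ℤ × ℤ → ℂ) (N : ℕ × ℕ) :
    boxAvg (fun n => g n - g' n) N = boxAvg g N - boxAvg g' N := by
  simp [boxAvg, sum_sub_distrib, mul_sub]

lemma boxAvg_const_mul (c : ℂ) (g : ℤ × ℤ → ℂ) (N : ℕ × ℕ) :
    boxAvg (fun n => c * g n) N = c * boxAvg g N := by
  simp only [boxAvg, ← mul_sum]; ring

lemma boxAvg_sum {ι : Type*} (s : Finset ι) (g : ι → ℤ × ℤ → ℂ) (N : ℕ × ℕ) :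
    boxAvg (fun n => ∑ i ∈ s, g i n) N = ∑ i ∈ s, boxAvg (g i) N := by
  simp only [boxAvg]; rw [sum_comm, mul_sum]

lemma norm_boxAvg_le {g : ℤ × ℤ → ℂ} {C : ℝ} (hC : 0 ≤ C) (hg : ∀ n, ‖g n‖ ≤ C) (N : ℕ × ℕ) :
    ‖boxAvg g N‖ ≤ C := by
  have h := norm_sum_le_of_le (Finset.Icc 1 N.1 ×ˢ Finset.Icc 1 N.2)
    (fun n _ => hg ((n.1 : ℤ), (n.2 : ℤ)))
  simp only [sum_const, card_product, Nat.card_Icc, add_tsub_cancel_right, nsmul_eq_mul,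
    Nat.cast_mul] at h
  simp only [boxAvg, norm_mul, norm_div, norm_one, Complex.norm_natCast]
  rw [one_div_mul_eq_div]
  exact div_le_of_le_mul₀ (by positivity) hC (h.trans_eq (mul_comm _ _))

lemma sq_norm_boxAvg_le (g : ℤ × ℤ → ℂ) (N : ℕ × ℕ) :
    ‖boxAvg g N‖ ^ 2 ≤ ‖boxAvg (fun n => g n * conj (g n)) N‖ := by
  set s := Finset.Icc 1 N.1 ×ˢ Finset.Icc 1 N.2 with hs
  have hcard : (#s : ℝ) = (N.1 : ℝ) * N.2 := by simp [hs]
  have h2 : ∑ n ∈ s, g ((n.1 : ℤ), (n.2 : ℤ)) * conj (g ((n.1 : ℤ), (n.2 : ℤ)))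
      = ((∑ n ∈ s, ‖g ((n.1 : ℤ), (n.2 : ℤ))‖ ^ 2 : ℝ) : ℂ) := by
    push_cast
    exact sum_congr rfl fun n _ => RCLike.mul_conj _
  have h3 : ‖∑ n ∈ s, g ((n.1 : ℤ), (n.2 : ℤ))‖ ^ 2
      ≤ ((N.1 : ℝ) * N.2) * ∑ n ∈ s, ‖g ((n.1 : ℤ), (n.2 : ℤ))‖ ^ 2 := by
    rw [← hcard]
    exact (pow_le_pow_left₀ (norm_nonneg _) (norm_sum_le _ _) 2).trans sq_sum_le_card_mul_sum_sq
  have h4 : 0 ≤ ∑ n ∈ s, ‖g ((n.1 : ℤ), (n.2 : ℤ))‖ ^ 2 := by positivity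
  simp only [boxAvg, ← hs, h2, norm_mul, norm_div, norm_one, Complex.norm_natCast,
    Complex.norm_real, Real.norm_of_nonneg h4, mul_pow]
  rcases eq_or_lt_of_le (show 0 ≤ (N.1 : ℝ) * N.2 by positivity) with h0 | h0
  · simp [← h0]
  · calc _ ≤ (1 / ((N.1 : ℝ) * N.2)) ^ 2 *
          (((N.1 : ℝ) * N.2) * ∑ n ∈ s, ‖g ((n.1 : ℤ), (n.2 : ℤ))‖ ^ 2) := by gcongr
      _ = _ := by field_simp

lemma norm_boxAvg_shift_fst_sub_le {g : ℤ × ℤ → ℂ} {C : ℝ} (hg : ∀ n, ‖g n‖ ≤ C) (N : ℕ × ℕ) :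
    ‖boxAvg (fun n => g (n + (1, 0)) - g n) N‖ ≤ 2 * C / N.1 := by
  have hC : 0 ≤ C := (norm_nonneg _).trans (hg 0)
  have h : ‖∑ n ∈ Finset.Icc 1 N.1 ×ˢ Finset.Icc 1 N.2,
      (g (((n.1 : ℤ), (n.2 : ℤ)) + (1, 0)) - g ((n.1 : ℤ), (n.2 : ℤ)))‖ ≤ N.2 * (2 * C) := by
    rw [sum_product_right]
    refine (norm_sum_le_of_le _ (fun b _ => ?_)).trans_eq (b := ∑ b ∈ Finset.Icc 1 N.2, 2 * C)
      (by simp)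
    have := Finset.sum_Ico_sub (fun a : ℕ => g ((a : ℤ), (b : ℤ))) (Nat.le_add_left 1 N.1)
    rw [Finset.Ico_add_one_right_eq_Icc] at this
    simp only [Nat.cast_add, Nat.cast_one] at this
    simp only [Prod.mk_add_mk, add_zero, this]
    calc _ ≤ C + C := (norm_sub_le _ _).trans (add_le_add (hg _) (hg _))
      _ = 2 * C := by ring
  simp only [boxAvg, norm_mul, norm_div, norm_one, Complex.norm_natCast]
  rcases eq_or_lt_of_le (show 0 ≤ (N.2 : ℝ) by positivity) with h0 | h0
  · rw [← h0]; simp; positivity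
  · calc _ ≤ 1 / ((N.1 : ℝ) * N.2) * (N.2 * (2 * C)) := by gcongr
      _ = _ := by field_simp

lemma boxAvg_swap (g : ℤ × ℤ → ℂ) (N : ℕ × ℕ) :
    boxAvg (fun n => g n.swap) N.swap = boxAvg g N := by
  simp only [boxAvg, Prod.fst_swap, Prod.snd_swap, Prod.swap_prod_mk, mul_comm (N.2 : ℂ)]
  rw [sum_product_right, sum_product]

lemma norm_boxAvg_shift_snd_sub_le {g : ℤ × ℤ → ℂ} {C : ℝ} (hg : ∀ n, ‖g n‖ ≤ C) (N : ℕ × ℕ) :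
    ‖boxAvg (fun n => g (n + (0, 1)) - g n) N‖ ≤ 2 * C / N.2 := by
  rw [← boxAvg_swap]
  exact norm_boxAvg_shift_fst_sub_le (g := fun n => g n.swap) (fun n => hg _) N.swap

/-- The shifts under which box averages of bounded functions are asymptotically invariant. -/
def asymptoticPeriods : AddSubgroup (ℤ × ℤ) where
  carrier := {h | ∀ (g : ℤ × ℤ → ℂ) (C : ℝ), (∀ n, ‖g n‖ ≤ C) →
    Tendsto (boxAvg (fun n => g (n + h) - g n)) atTop (nhds 0)}
  zero_mem' := by
    intro g C _
    simp
  add_mem' := by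
    intro h k hh hk g C hg
    have := (hk (fun n => g (n + h)) C (fun n => hg _)).add (hh g C hg)
    rw [add_zero] at this
    refine this.congr fun N => ?_
    rw [← boxAvg_add]
    congr 1; ext n
    rw [add_comm h k, add_assoc]; ring
  neg_mem' := by
    intro h hh g C hg
    have := (hh (fun n => g (n + -h)) C (fun n => hg _)).neg
    rw [neg_zero] at this
    refine this.congr fun N => ?_
    rw [boxAvg_sub, boxAvg_sub, neg_sub]
    simp

lemma asymptoticPeriods_eq_top : asymptoticPeriods = ⊤ := by
  have hdiv (C : ℝ) : Tendsto (fun k : ℕ => 2 * C / (k : ℝ)) atTop (nhds 0) :=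
    tendsto_const_div_atTop_nhds_zero_nat _
  have h1 : ((1 : ℤ), (0 : ℤ)) ∈ asymptoticPeriods := fun g C hg =>
    squeeze_zero_norm (norm_boxAvg_shift_fst_sub_le hg) <| (hdiv C).comp <| by
      rw [← prod_atTop_atTop_eq]; exact tendsto_fst
  have h2 : ((0 : ℤ), (1 : ℤ)) ∈ asymptoticPeriods := fun g C hg =>
    squeeze_zero_norm (norm_boxAvg_shift_snd_sub_le hg) <| (hdiv C).comp <| by
      rw [← prod_atTop_atTop_eq]; exact tendsto_snd
  refine (AddSubgroup.eq_top_iff' _).2 fun ⟨a, b⟩ => ?_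
  simpa using add_mem (zsmul_mem h1 a) (zsmul_mem h2 b)

lemma tendsto_boxAvg_shift_sub {g : ℤ × ℤ → ℂ} {C : ℝ} (hg : ∀ n, ‖g n‖ ≤ C) (h : ℤ × ℤ) :
    Tendsto (fun N => boxAvg (fun n => g (n + h)) N - boxAvg g N) atTop (nhds 0) := by
  have : h ∈ asymptoticPeriods := asymptoticPeriods_eq_top ▸ AddSubgroup.mem_top h
  exact (this g C hg).congr fun N => boxAvg_sub _ _ N

open Classical in
/-- Van der Corput's inequality in the limit: if the correlations of `u` along `D` vanish and `D`
contains almost all differences of finite sets, then the averages of `u` vanish. -/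
lemma tendsto_boxAvg_zero_of_correlations {u : ℤ × ℤ → ℂ} (hu : ∀ n, ‖u n‖ ≤ 1) {D : Set (ℤ × ℤ)}
    (hD : ∀ ε > 0, ∃ B : Finset (ℤ × ℤ), B.Nonempty ∧
      (#{p ∈ B ×ˢ B | p.1 - p.2 ∉ D} : ℝ) ≤ ε * (#B : ℝ) ^ 2)
    (hcor : ∀ d ∈ D, Tendsto (boxAvg (fun n => u (n + d) * conj (u n))) atTop (nhds 0)) :
    Tendsto (boxAvg u) atTop (nhds 0) := by
  have hmul (a b : ℤ × ℤ) : ‖u a * conj (u b)‖ ≤ 1 := by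
    rw [norm_mul, RCLike.norm_conj]
    exact mul_le_one₀ (hu a) (norm_nonneg _) (hu b)
  rw [Metric.tendsto_nhds]
  intro ε hε
  obtain ⟨B, hB, hbad⟩ := hD (ε ^ 2 / 8) (by positivity)
  have hc : (0 : ℝ) < #B := by exact_mod_cast hB.card_pos
  set v : ℤ × ℤ → ℂ := fun n => ∑ h ∈ B, u (n + h) with hv
  have hshift : Tendsto (fun N => boxAvg v N - #B * boxAvg u N) atTop (nhds 0) := by
    have := tendsto_finsetSum B fun h _ => tendsto_boxAvg_shift_sub hu h
    simpa [hv, boxAvg_sum, sum_sub_distrib] using this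
  have hgood : Tendsto (fun N => ∑ p ∈ B ×ˢ B with p.1 - p.2 ∈ D,
      ‖boxAvg (fun n => u (n + p.1) * conj (u (n + p.2))) N‖) atTop (nhds 0) := by
    rw [← sum_const_zero (s := {p ∈ B ×ˢ B | p.1 - p.2 ∈ D})]
    refine tendsto_finsetSum _ fun p hp => ?_
    have h1 := (tendsto_boxAvg_shift_sub (g := fun n => u (n + (p.1 - p.2)) * conj (u n))
      (fun n => hmul _ _) p.2).add (hcor _ (mem_filter.1 hp).2)
    simpa [add_assoc] using h1.norm
  have hv2 (N : ℕ × ℕ) : ‖boxAvg v N‖ ^ 2 ≤ ε ^ 2 / 8 * (#B : ℝ) ^ 2 +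
      ∑ p ∈ B ×ˢ B with p.1 - p.2 ∈ D,
        ‖boxAvg (fun n => u (n + p.1) * conj (u (n + p.2))) N‖ := by
    have hexp : (fun n => v n * conj (v n)) =
        fun n => ∑ p ∈ B ×ˢ B, u (n + p.1) * conj (u (n + p.2)) := by
      ext n
      simp only [hv, map_sum, sum_mul_sum, sum_product]
    refine (sq_norm_boxAvg_le v N).trans ?_
    rw [hexp, boxAvg_sum]
    refine (norm_sum_le _ _).trans ?_
    rw [← sum_filter_add_sum_filter_not _ (fun p : (ℤ × ℤ) × (ℤ × ℤ) => p.1 - p.2 ∈ D), add_comm]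
    refine add_le_add_left (le_trans ?_ hbad) _
    refine (sum_le_card_nsmul _ _ 1 fun p _ => norm_boxAvg_le zero_le_one ?_ N).trans_eq (by simp)
    exact fun n => hmul _ _
  filter_upwards [hgood.eventually_lt_const (show 0 < ε ^ 2 / 8 * (#B : ℝ) ^ 2 by positivity),
    (Metric.tendsto_nhds.1 hshift) (ε / 2 * #B) (by positivity)] with N h1 h2
  rw [dist_zero_right] at h2 ⊢
  have h3 : ‖boxAvg v N‖ ≤ ε / 2 * #B :=
    abs_le_of_sq_le_sq' (by nlinarith [hv2 N]) (by positivity) |>.2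
  have h4 : (#B : ℝ) * ‖boxAvg u N‖ < #B * ε := by
    calc (#B : ℝ) * ‖boxAvg u N‖ = ‖boxAvg v N - (boxAvg v N - #B * boxAvg u N)‖ := by simp
      _ ≤ ‖boxAvg v N‖ + ‖boxAvg v N - #B * boxAvg u N‖ := norm_sub_le _ _
      _ < #B * ε := by linarith
  exact lt_of_mul_lt_mul_left h4 hc.le

open Classical in
lemma exists_card_sub_notMem_le {D : Set (ℤ × ℤ)}
    (hδ : (⨆ H : ℕ × ℕ,
        (Set.ncard (D ∩ Set.Icc (-(H.1 : ℤ), -(H.2 : ℤ)) ((H.1 : ℤ), (H.2 : ℤ))) : ℝ) /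
          ((2 * (H.1 : ℝ) + 1) * (2 * (H.2 : ℝ) + 1))) = 1) {ε : ℝ} (hε : 0 < ε) :
    ∃ B : Finset (ℤ × ℤ), B.Nonempty ∧
      (#{p ∈ B ×ˢ B | p.1 - p.2 ∉ D} : ℝ) ≤ ε * (#B : ℝ) ^ 2 := by
  obtain ⟨H, hH⟩ := exists_lt_of_lt_ciSup (lt_of_lt_of_eq (sub_lt_self 1 (by positivity)) hδ.symm :
    1 - ε / 4 < _)
  set I : Finset (ℤ × ℤ) := Finset.Icc (-(H.1 : ℤ), -(H.2 : ℤ)) ((H.1 : ℤ), (H.2 : ℤ)) with hI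
  set B : Finset (ℤ × ℤ) := Finset.Icc 0 ((H.1 : ℤ), (H.2 : ℤ)) with hB
  have hIcard : (#I : ℝ) = (2 * (H.1 : ℝ) + 1) * (2 * (H.2 : ℝ) + 1) := by
    have : #I = (2 * H.1 + 1) * (2 * H.2 + 1) := by
      rw [hI, Finset.card_Icc_prod, Int.card_Icc, Int.card_Icc]
      congr 1 <;> omega
    rw [this]; push_cast; ring
  have hBcard : (#B : ℝ) = ((H.1 : ℝ) + 1) * ((H.2 : ℝ) + 1) := by
    have : #B = (H.1 + 1) * (H.2 + 1) := by
      rw [hB, Finset.card_Icc_prod, Int.card_Icc, Int.card_Icc]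
      congr 1
    rw [this]; push_cast; ring
  have hncard : Set.ncard (D ∩ Set.Icc (-(H.1 : ℤ), -(H.2 : ℤ)) ((H.1 : ℤ), (H.2 : ℤ)))
      = #{d ∈ I | d ∈ D} := by
    rw [← Set.ncard_coe_finset]
    congr 1; ext d; simp [hI]; tauto
  have hbad : (#{d ∈ I | d ∉ D} : ℝ) ≤ ε * #B := by
    have h1 : (#{d ∈ I | d ∈ D} : ℝ) + #{d ∈ I | d ∉ D} = #I := by
      exact_mod_cast card_filter_add_card_filter_not (s := I) (fun d => d ∈ D)
    rw [hncard, ← hIcard, lt_div_iff₀ (by rw [hIcard]; positivity)] at hH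
    have h2 : (#I : ℝ) ≤ 4 * #B := by
      rw [hIcard, hBcard]
      nlinarith [Nat.cast_nonneg (α := ℝ) H.1, Nat.cast_nonneg (α := ℝ) H.2]
    nlinarith
  refine ⟨B, ⟨0, by simp [hB, Prod.le_def]⟩, ?_⟩
  have hinj : #{p ∈ B ×ˢ B | p.1 - p.2 ∉ D} ≤ #({d ∈ I | d ∉ D} ×ˢ B) := by
    refine card_le_card_of_injOn (fun p => (p.1 - p.2, p.2)) ?_ ?_
    · rintro ⟨⟨a, b⟩, ⟨c, d⟩⟩ hp
      simp [hB, hI, Prod.le_def] at hp ⊢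
      exact ⟨⟨by omega, hp.2⟩, by omega⟩
    · rintro ⟨a, b⟩ _ ⟨c, d⟩ _ h
      simp only [Prod.mk.injEq] at h
      obtain ⟨h1, rfl⟩ := h
      simpa using h1
  calc (#{p ∈ B ×ˢ B | p.1 - p.2 ∉ D} : ℝ) ≤ #{d ∈ I | d ∉ D} * #B := by
        rw [card_product] at hinj; exact_mod_cast hinj
    _ ≤ ε * #B * #B := by gcongr
    _ = ε * (#B : ℝ) ^ 2 := by ring

lemma integral_fourier_one {k : ℤ} (hk : k ≠ 0) :
    ∫ t in (0:ℝ)..1, fourier k (t : AddCircle (1 : ℝ)) = 0 := by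
  have h : (2 * Real.pi * Complex.I * k : ℂ) ≠ 0 := by
    simp [hk, Real.pi_ne_zero]
  simp only [fourier_coe_apply, Complex.ofReal_one, div_one]
  rw [integral_exp_mul_complex h]
  have : Complex.exp (2 * Real.pi * Complex.I * k * (1 : ℝ)) = 1 :=
    Complex.exp_eq_one_iff.2 ⟨k, by push_cast; ring⟩
  rw [this]
  simp

lemma tendsto_boxAvg_one : Tendsto (boxAvg fun _ => 1) atTop (nhds 1) := by
  refine tendsto_const_nhds.congr' ?_
  filter_upwards [eventually_ge_atTop ((1, 1) : ℕ × ℕ)] with N hN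
  have h1 : (N.1 : ℂ) ≠ 0 := Nat.cast_ne_zero.2 (Nat.one_le_iff_ne_zero.1 hN.1)
  have h2 : (N.2 : ℂ) ≠ 0 := Nat.cast_ne_zero.2 (Nat.one_le_iff_ne_zero.1 hN.2)
  simp [boxAvg]
  field_simp

/-- **Weyl's criterion** for double sequences. -/
lemma IsUD2.of_fourier {x : ℤ × ℤ → ℝ}
    (h : ∀ k : ℤ, k ≠ 0 →
      Tendsto (boxAvg fun n => fourier k (x n : AddCircle (1 : ℝ))) atTop (nhds 0)) :
    IsUD2 x := by
  have h_integrable (p : C(AddCircle (1 : ℝ), ℂ)) :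
      IntervalIntegrable (fun t : ℝ => p (t : AddCircle (1 : ℝ))) MeasureTheory.volume 0 1 :=
    (p.continuous.comp (AddCircle.continuous_mk' 1)).intervalIntegrable _ _
  have hspan : ∀ p ∈ Submodule.span ℂ (Set.range (fourier (T := 1))),
      Tendsto (boxAvg fun n => p (x n : AddCircle (1 : ℝ))) atTop
        (nhds (∫ t in (0:ℝ)..1, p (t : AddCircle (1 : ℝ)))) := by
    intro p hp
    induction hp using Submodule.span_induction with
    | mem p hp =>
      obtain ⟨k, rfl⟩ := hp
      rcases eq_or_ne k 0 with rfl | hk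
      · simpa using tendsto_boxAvg_one
      · rw [integral_fourier_one hk]
        exact h k hk
    | zero => simp
    | add p q _ _ hp hq =>
      simp only [ContinuousMap.add_apply]
      rw [intervalIntegral.integral_add (h_integrable p) (h_integrable q)]
      exact (hp.add hq).congr fun N => (boxAvg_add _ _ N).symm
    | smul c p _ hp =>
      simp only [ContinuousMap.smul_apply, smul_eq_mul, intervalIntegral.integral_const_mul]
      exact (hp.const_mul c).congr fun N => (boxAvg_const_mul _ _ N).symm
  intro f hf hper
  let F : C(AddCircle (1 : ℝ), ℂ) :=
    ⟨Function.Periodic.lift (c := (1 : ℝ)) hper, continuous_coinduced_dom.2 hf⟩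
  have hF (t : ℝ) : F (t : AddCircle (1 : ℝ)) = f t := rfl
  change Tendsto (boxAvg fun n => F (x n : AddCircle (1 : ℝ))) atTop
    (nhds (∫ t in (0:ℝ)..1, F (t : AddCircle (1 : ℝ))))
  rw [Metric.tendsto_nhds]
  intro ε hε
  have hmem : F ∈ (Submodule.span ℂ (Set.range (fourier (T := 1)))).topologicalClosure := by
    have : Fact ((0 : ℝ) < 1) := ⟨one_pos⟩
    rw [span_fourier_closure_eq_top]; trivial
  obtain ⟨p, hp, hFp⟩ := Metric.mem_closure_iff.1 hmem (ε / 3) (by positivity)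
  rw [dist_eq_norm] at hFp
  have hle (y : AddCircle (1 : ℝ)) : ‖F y - p y‖ ≤ ε / 3 :=
    ((F - p).norm_coe_le_norm y).trans hFp.le
  filter_upwards [Metric.tendsto_nhds.1 (hspan p hp) (ε / 3) (by positivity)] with N hN
  rw [dist_eq_norm] at hN ⊢
  have h1 : ‖boxAvg (fun n => F (x n : AddCircle (1 : ℝ))) N
      - boxAvg (fun n => p (x n : AddCircle (1 : ℝ))) N‖ ≤ ε / 3 := by
    rw [← boxAvg_sub]
    exact norm_boxAvg_le (by positivity) (fun n => hle _) N
  have h2 : ‖(∫ t in (0:ℝ)..1, F (t : AddCircle (1 : ℝ)))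
      - ∫ t in (0:ℝ)..1, p (t : AddCircle (1 : ℝ))‖ ≤ ε / 3 := by
    rw [← intervalIntegral.integral_sub (h_integrable F) (h_integrable p)]
    refine (intervalIntegral.norm_integral_le_of_norm_le_const fun t _ => hle t).trans_eq ?_
    simp
  rw [norm_sub_rev] at h2
  refine lt_of_le_of_lt (norm_sub_le_norm_sub_add_norm_sub _
    (boxAvg (fun n => p (x n : AddCircle (1 : ℝ))) N) _) ?_
  have := norm_sub_le_norm_sub_add_norm_sub (boxAvg (fun n => p (x n : AddCircle (1 : ℝ))) N)
    (∫ t in (0:ℝ)..1, p (t : AddCircle (1 : ℝ))) (∫ t in (0:ℝ)..1, F (t : AddCircle (1 : ℝ)))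
  linarith

/-- If `δ(D) = 1` and all the difference families `(x_{n+d} - x_n)`, `d ∈ D`, are u.d. mod 1,
then `(x_n)` is u.d. mod 1. -/
theorem stmt_2 (D : Set (ℤ × ℤ)) (hD0 : ((0 : ℤ), (0 : ℤ)) ∉ D)
    (hδ : (⨆ H : ℕ × ℕ,
        (Set.ncard (D ∩ Set.Icc (-(H.1 : ℤ), -(H.2 : ℤ)) ((H.1 : ℤ), (H.2 : ℤ))) : ℝ) /
          ((2 * (H.1 : ℝ) + 1) * (2 * (H.2 : ℝ) + 1))) = 1)
    (x : ℤ × ℤ → ℝ)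
    (hx : ∀ d ∈ D, IsUD2 (fun n => x (n + d) - x n)) :
    IsUD2 x := by
  refine IsUD2.of_fourier fun k hk => tendsto_boxAvg_zero_of_correlations (D := D)
    (fun n => (Circle.norm_coe _).le) (fun ε hε => exists_card_sub_notMem_le hδ hε) fun d hd => ?_
  have h := hx d hd (fun t => fourier k (t : AddCircle (1 : ℝ)))
    ((fourier k).continuous.comp (AddCircle.continuous_mk' 1))
    (fun t => by rw [AddCircle.coe_add_period])
  rw [integral_fourier_one hk] at h
  refine h.congr fun N => ?_
  change boxAvg (fun n => fourier k ((x (n + d) - x n : ℝ) : AddCircle (1 : ℝ))) N = _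
  congr 1; ext n
  simp only [fourier_apply, sub_eq_add_neg, AddCircle.coe_add, AddCircle.coe_neg,
    smul_add, smul_neg, AddCircle.toCircle_add, Circle.coe_mul]
  rw [fourier_neg', fourier_apply]
end

section
/- Let D ⊂ ℤ \ {0}. The set D is a set of recurrence if and only if it satisfies the following van der Corput type property: for every sequence (u_n)_{n∈ℕ} with values in {0,1} such that for every d ∈ D the limit γ(d) := lim_{N→∞} (1/N) ∑_{n=1}^{N} u_{n+d} u_n exists and equals 0, one has lim_{N→∞} (1/N) ∑_{n=1}^{N} u_n = 0. -/
open Filter Finset MeasureTheory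

/-- `D ⊆ ℤ \ {0}` is a set of recurrence: for every invertible measure-preserving
transformation `T` of a probability space and every set `A` of positive measure there is
`d ∈ D` with `μ(A ∩ T^d A) > 0`. -/
def IsRecurrenceSet (D : Set ℤ) : Prop :=
  ∀ (X : Type*) (_ : MeasurableSpace X) (μ : Measure X), IsProbabilityMeasure μ →
    ∀ T : X ≃ᵐ X, MeasurePreserving T μ μ →
      ∀ A : Set X, MeasurableSet A → 0 < μ A →
        ∃ d ∈ D, 0 < μ (A ∩ ⇑(T.toEquiv ^ d) '' A)

/-- The empirical averages of `N` points are integrals against a probability measure. -/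
lemma exists_empirical {X : Type*} [TopologicalSpace X] [MeasurableSpace X] [BorelSpace X]
    (p : ℕ → X) (N : ℕ) :
    ∃ P : ProbabilityMeasure X, N ≠ 0 → ∀ f : BoundedContinuousFunction X ℝ,
      ∫ x, f x ∂(P : Measure X) = (1 / (N : ℝ)) * ∑ n ∈ Finset.Icc 1 N, f (p n) := by
  rcases eq_or_ne N 0 with rfl | hN
  · exact ⟨⟨Measure.dirac (p 0), inferInstance⟩, fun h => absurd rfl h⟩
  have hN' : (N : ENNReal) ≠ 0 := by exact_mod_cast hN
  refine ⟨⟨(N : ENNReal)⁻¹ • ∑ n ∈ Finset.Icc 1 N, Measure.dirac (p n), ⟨?_⟩⟩, fun _ f => ?_⟩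
  · simp [ENNReal.inv_mul_cancel hN' (ENNReal.natCast_ne_top N)]
  · simp only [ProbabilityMeasure.coe_mk]
    rw [integral_smul_measure, integral_finsetSum_measure (fun i _ => f.integrable _)]
    simp [integral_dirac' _ _ f.continuous.stronglyMeasurable]

/-- **Krylov–Bogolyubov** along an ultrafilter: the orbit of a point generates an invariant
probability measure which computes the limiting frequencies of visits to clopen sets. -/
lemma exists_invariant_measure {X : Type*} [TopologicalSpace X] [CompactSpace X] [T2Space X]
    [MeasurableSpace X] [BorelSpace X] [HasOuterApproxClosed X] (φ : X ≃ₜ X) (p : ℕ → X)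
    (hp : ∀ n, φ (p n) = p (n + 1)) (U : Ultrafilter ℕ) (hU : (U : Filter ℕ) ≤ atTop) :
    ∃ μ : ProbabilityMeasure X, MeasurePreserving φ (μ : Measure X) μ ∧
      ∀ E : Set X, IsClopen E →
        Tendsto (fun N : ℕ => (1 / (N : ℝ)) * ∑ n ∈ Finset.Icc 1 N, E.indicator 1 (p n)) U
          (nhds ((μ : Measure X).real E)) := by
  choose P hP using exists_empirical p
  obtain ⟨μ, -, hμ⟩ := isCompact_univ.ultrafilter_le_nhds (U.map P) (by simp)
  have hlim : Tendsto P U (nhds μ) := hμ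
  rw [ProbabilityMeasure.tendsto_iff_forall_integral_tendsto] at hlim
  have hne : ∀ᶠ N : ℕ in U, N ≠ 0 := hU (eventually_ne_atTop 0)
  have key : ∀ f : BoundedContinuousFunction X ℝ,
      Tendsto (fun N : ℕ => (1 / (N : ℝ)) * ∑ n ∈ Finset.Icc 1 N, f (p n)) U
        (nhds (∫ x, f x ∂(μ : Measure X))) := fun f =>
    (hlim f).congr' (by filter_upwards [hne] with N hN using hP N hN f)
  refine ⟨μ, ⟨φ.continuous.measurable, ?_⟩, fun E hE => ?_⟩
  · have : IsProbabilityMeasure (Measure.map φ (μ : Measure X)) :=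
      Measure.isProbabilityMeasure_map φ.continuous.aemeasurable
    refine ext_of_forall_integral_eq_of_IsFiniteMeasure fun f => ?_
    rw [integral_map φ.continuous.aemeasurable f.continuous.aestronglyMeasurable]
    have h1 := (key (f.compContinuous ⟨φ, φ.continuous⟩)).sub (key f)
    have h0 : Tendsto (fun N : ℕ => 2 * ‖f‖ / (N : ℝ)) U (nhds 0) :=
      (tendsto_const_div_atTop_nhds_zero_nat _).mono_left hU
    have h2 := tendsto_nhds_unique h1 (squeeze_zero_norm (fun N => ?_) h0)
    · exact sub_eq_zero.mp h2
    · simp only [BoundedContinuousFunction.compContinuous_apply, ContinuousMap.coe_mk, hp]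
      have htel : ∑ n ∈ Finset.Icc 1 N, (f (p (n + 1)) - f (p n)) = f (p (N + 1)) - f (p 1) := by
        rw [← Finset.Ico_add_one_right_eq_Icc]
        exact Finset.sum_Ico_sub (fun n => f (p n)) (by omega)
      rw [← mul_sub, ← Finset.sum_sub_distrib, htel, norm_mul, one_div, norm_inv,
        RCLike.norm_natCast, inv_mul_eq_div]
      gcongr
      linarith [norm_sub_le (f (p (N + 1))) (f (p 1)), f.norm_coe_le_norm (p (N + 1)),
        f.norm_coe_le_norm (p 1)]
  · let f : BoundedContinuousFunction X ℝ := BoundedContinuousFunction.mkOfCompact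
      ⟨E.indicator 1, (continuous_const (y := (1 : ℝ))).indicator (by simp [hE.frontier_eq])⟩
    have h := key f
    rwa [show ∫ x, f x ∂(μ : Measure X) = (μ : Measure X).real E from
      integral_indicator_one hE.isOpen.measurableSet] at h

/-- Powers of the one-step backward shift on bi-infinite sequences. -/
lemma perm_zpow_apply_of_shift {S : Type*} (e : Equiv.Perm (ℤ → S))
    (he : ∀ x m, e x m = x (m - 1)) (d : ℤ) (x : ℤ → S) (m : ℤ) : (e ^ d) x m = x (m - d) := by
  have he' : ∀ x m, e⁻¹ x m = x (m + 1) := fun x m => by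
    have := he (e⁻¹ x) (m + 1)
    simpa using this.symm
  induction d generalizing x with
  | zero => simp
  | succ i ih =>
    rw [zpow_add_one, Equiv.Perm.mul_apply, ih, he]; congr 1; ring
  | pred i ih =>
    rw [zpow_sub_one, Equiv.Perm.mul_apply, ih, he']; congr 1; ring

/-- The one-step shift homeomorphism on bi-infinite sequences. -/
def shiftHomeomorph (S : Type*) [TopologicalSpace S] : (ℤ → S) ≃ₜ (ℤ → S) where
  toFun x m := x (m + 1)
  invFun x m := x (m - 1)
  left_inv x := by simp
  right_inv x := by simp
  continuous_toFun := by fun_prop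
  continuous_invFun := by fun_prop

/-- A set of recurrence has the van der Corput type property, by Furstenberg correspondence. -/
lemma IsRecurrenceSet.tendsto_average.{v} {D : Set ℤ} (hR : IsRecurrenceSet.{v} D) (u : ℤ → ℝ)
    (hu : ∀ n, u n = 0 ∨ u n = 1)
    (hD : ∀ d ∈ D, Tendsto (fun N : ℕ =>
      (1 / (N : ℝ)) * ∑ n ∈ Finset.Icc 1 N, u ((n : ℤ) + d) * u (n : ℤ)) atTop (nhds 0)) :
    Tendsto (fun N : ℕ => (1 / (N : ℝ)) * ∑ n ∈ Finset.Icc 1 N, u (n : ℤ)) atTop (nhds 0) := by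
  classical
  rw [tendsto_iff_ultrafilter]
  intro U hU
  let S := ULift.{v} Bool
  let _ : MeasurableSpace (ℤ → S) := borel _
  have : BorelSpace (ℤ → S) := ⟨rfl⟩
  let φ := shiftHomeomorph S
  let p : ℕ → ℤ → S := fun n m => ⟨decide (u (n + m) = 1)⟩
  have hp : ∀ n, φ (p n) = p (n + 1) := fun n => by
    funext m
    have h : (n : ℤ) + (m + 1) = ((n + 1 : ℕ) : ℤ) + m := by push_cast; ring
    change (⟨decide (u (n + (m + 1)) = 1)⟩ : S) = ⟨decide (u ((n + 1 : ℕ) + m) = 1)⟩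
    rw [h]
  obtain ⟨μ, hμ, hlim⟩ := exists_invariant_measure φ p hp U hU
  let C : ℤ → Set (ℤ → S) := fun d => (fun x => x d) ⁻¹' {⟨true⟩}
  have hC : ∀ d, IsClopen (C d) := fun d =>
    (isClopen_discrete ({⟨true⟩} : Set S)).preimage (f := fun x : ℤ → S => x d)
      (continuous_apply d)
  have hind : ∀ d n, (C d).indicator (1 : (ℤ → S) → ℝ) (p n) = u (n + d) := fun d n => by
    rcases hu (n + d) with h | h
    · simp only [C, p, Set.indicator_apply, h, Set.mem_preimage, Set.mem_singleton_iff]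
      exact if_neg fun h' => by simpa using congrArg ULift.down h'
    · simp [C, p, h]
  have h0 := hlim (C 0) (hC 0)
  simp only [hind, add_zero] at h0
  suffices hz : (μ : Measure (ℤ → S)) (C 0) = 0 by simpa [measureReal_def, hz] using h0
  by_contra hz
  obtain ⟨d, hd, hpos⟩ := hR (ℤ → S) _ μ inferInstance φ.symm.toMeasurableEquiv
    (hμ.symm φ.toMeasurableEquiv) (C 0) (hC 0).isOpen.measurableSet (pos_iff_ne_zero.mpr hz)
  have himg : ⇑(φ.symm.toMeasurableEquiv.toEquiv ^ d) '' C 0 = C d := by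
    have hs := perm_zpow_apply_of_shift φ.symm.toMeasurableEquiv.toEquiv (fun _ _ => rfl)
    ext y
    constructor
    · rintro ⟨x, hx, rfl⟩
      simpa [C, hs] using hx
    · intro hy
      refine ⟨(φ.symm.toMeasurableEquiv.toEquiv ^ (-d)) y, ?_, ?_⟩
      · rw [Set.mem_preimage, hs]
        simpa [C] using hy
      · rw [← Equiv.Perm.mul_apply, ← zpow_add]; simp
  rw [himg] at hpos
  have h1 := hlim _ ((hC 0).inter (hC d))
  simp only [Set.inter_indicator_one, Pi.mul_apply, hind, add_zero] at h1
  have h2 := tendsto_nhds_unique h1 (((hD d hd).congr fun N => by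
    simp only [mul_comm]).mono_left hU)
  rw [measureReal_eq_zero_iff] at h2
  exact hpos.ne' h2

/-- The van der Corput type property implies recurrence. -/
lemma isRecurrenceSet_of_tendsto_average {D : Set ℤ}
    (h : ∀ u : ℤ → ℝ, (∀ n, u n = 0 ∨ u n = 1) →
      (∀ d ∈ D, Tendsto (fun N : ℕ =>
          (1 / (N : ℝ)) * ∑ n ∈ Finset.Icc 1 N, u ((n : ℤ) + d) * u (n : ℤ)) atTop (nhds 0)) →
      Tendsto (fun N : ℕ => (1 / (N : ℝ)) * ∑ n ∈ Finset.Icc 1 N, u (n : ℤ)) atTop (nhds 0)) :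
    IsRecurrenceSet D := by
  classical
  intro X _ μ _ T hT A hA hpos
  by_contra! hcon
  have hmeas : ∀ d : ℤ, ∃ S : X ≃ᵐ X, S.toEquiv = T.toEquiv ^ d ∧ MeasurePreserving S μ μ := by
    intro d
    induction d with
    | zero => exact ⟨MeasurableEquiv.refl X, by ext; simp, MeasurePreserving.id μ⟩
    | succ i ih =>
      obtain ⟨S, hS, hS'⟩ := ih
      exact ⟨T.trans S, by rw [zpow_add_one, ← hS]; rfl, hS'.comp hT⟩
    | pred i ih =>
      obtain ⟨S, hS, hS'⟩ := ih
      exact ⟨T.symm.trans S, by rw [zpow_sub_one, ← hS]; rfl, hS'.comp (hT.symm T)⟩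
  choose S hS hSμ using hmeas
  have hS' : ∀ d x, (T.toEquiv ^ d) x = S d x := fun d x => by rw [← hS]; rfl
  let B : Set X := A \ ⋃ d ∈ D, ⇑(T.toEquiv ^ d) '' A
  have hBm : MeasurableSet B := by
    refine hA.diff (MeasurableSet.biUnion D.to_countable fun d _ => ?_)
    rw [← hS]
    exact (S d).measurableSet_image.mpr hA
  have hBμ : μ B = μ A := by
    refine measure_sdiff_null' ?_
    rw [Set.inter_iUnion₂, measure_biUnion_null_iff D.to_countable]
    exact fun d hd => le_zero_iff.mp (hcon d hd)
  let u : X → ℤ → ℝ := fun x n => B.indicator 1 ((T.toEquiv ^ (-n)) x)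
  have hu : ∀ x n, u x n = 0 ∨ u x n = 1 := fun x n => by
    simp only [u, Set.indicator_apply]; split_ifs <;> simp
  have hzero : ∀ x, ∀ d ∈ D, ∀ n, u x (n + d) * u x n = 0 := by
    intro x d hd n
    simp only [u, Set.indicator_apply]
    split_ifs with h1 h2 <;> simp
    refine h2.2 (Set.mem_biUnion hd ⟨_, h1.1, ?_⟩)
    rw [← Equiv.Perm.mul_apply, ← zpow_add]
    congr 2
    ring
  have hlim : ∀ x, Tendsto (fun N : ℕ => (1 / (N : ℝ)) * ∑ n ∈ Finset.Icc 1 N, u x n) atTop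
      (nhds 0) := fun x => h (u x) (hu x) fun d hd => by simp [hzero x d hd]
  have hum : ∀ n, Measurable fun x => u x n := fun n => by
    simp only [u, hS']
    exact (measurable_one.indicator hBm).comp (S (-n)).measurable
  have hu1 : ∀ x n, ‖u x n‖ ≤ 1 := fun x n => by rcases hu x n with h | h <;> simp [h]
  have hui : ∀ n, ∫ x, u x n ∂μ = μ.real B := fun n => by
    simp only [u, hS']
    rw [(hSμ (-n)).integral_comp (S (-n)).measurableEmbedding]
    exact integral_indicator_one hBm
  have hint : Tendsto (fun N : ℕ => ∫ x, (1 / (N : ℝ)) * ∑ n ∈ Finset.Icc 1 N, u x n ∂μ) atTop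
      (nhds (∫ _, (0 : ℝ) ∂μ)) := by
    refine tendsto_integral_of_dominated_convergence (fun _ => 1) (fun N => ?_)
      (integrable_const _) (fun N => .of_forall fun x => ?_) (.of_forall hlim)
    · exact ((Finset.measurable_fun_sum (Finset.Icc 1 N) fun n _ => hum n).const_mul
        _).aestronglyMeasurable
    · rw [norm_mul]
      rcases eq_or_ne N 0 with rfl | hN
      · simp
      · have h1 : ‖∑ n ∈ Finset.Icc 1 N, u x n‖ ≤ N := by
          simpa using norm_sum_le_of_le (Finset.Icc 1 N) fun n _ => hu1 x n
        have hN' : (0 : ℝ) < N := by positivity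
        rw [norm_div, norm_one, RCLike.norm_natCast, one_div, inv_mul_le_iff₀ hN', mul_one]
        exact h1
  have hconst : ∀ᶠ N : ℕ in atTop,
      ∫ x, (1 / (N : ℝ)) * ∑ n ∈ Finset.Icc 1 N, u x n ∂μ = μ.real B := by
    filter_upwards [eventually_ne_atTop 0] with N hN
    rw [integral_const_mul, integral_finsetSum (Finset.Icc 1 N) fun n _ =>
      Integrable.of_bound (hum n).aestronglyMeasurable 1 (.of_forall fun x => hu1 x n)]
    simp only [hui]
    have : (N : ℝ) ≠ 0 := by exact_mod_cast hN
    simp [this]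
  have hfin := tendsto_nhds_unique (tendsto_const_nhds.congr' (hconst.mono fun _ h => h.symm)) hint
  rw [integral_zero, measureReal_eq_zero_iff, hBμ] at hfin
  exact hpos.ne' hfin

/-- `D` is a set of recurrence iff the van der Corput type property holds for `{0,1}`-valued
sequences. -/
theorem stmt_18 (D : Set ℤ) (hD : (0 : ℤ) ∉ D) :
    IsRecurrenceSet D ↔
      ∀ u : ℤ → ℝ, (∀ n, u n = 0 ∨ u n = 1) →
        (∀ d ∈ D, Tendsto (fun N : ℕ =>
            (1 / (N : ℝ)) * ∑ n ∈ Finset.Icc 1 N, u ((n : ℤ) + d) * u (n : ℤ))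
          atTop (nhds 0)) →
        Tendsto (fun N : ℕ => (1 / (N : ℝ)) * ∑ n ∈ Finset.Icc 1 N, u (n : ℤ))
          atTop (nhds 0) := by
  exact ⟨fun hR u hu h => hR.tendsto_average u hu h, isRecurrenceSet_of_tendsto_average⟩
end

section
/- Equivalent characterizations of strong recurrence: For an infinite set D ⊂ ℤ, the following are equivalent. (SR1) D is a set of strong recurrence. (SR2) For every E ⊂ ℕ with upper density d̄(E) > 0, there exist ε > 0 and infinitely many d ∈ D such that d̄(E ∩ (E+d)) > ε. (SR3) For every sequence (u_n)_{n∈ℕ} with values in {0,1} such that lim_{|d|→∞, d∈D} limsup_{N→∞} (1/N) ∑_{n=1}^{N} u_{n+d} u_n = 0, one has lim_{N→∞} (1/N) ∑_{n=1}^{N} u_n = 0. -/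
open Filter Finset MeasureTheory

/-- `D ⊆ ℤ` is a set of strong recurrence: for every invertible measure-preserving
transformation of a probability space and every set `A` of positive measure,
`limsup_{d∈D, |d|→∞} μ(A ∩ T^d A) > 0`. -/
def IsStrongRecurrenceSet (D : Set ℤ) : Prop :=
  ∀ (X : Type*) (_ : MeasurableSpace X) (μ : Measure X), IsProbabilityMeasure μ →
    ∀ T : X ≃ᵐ X, MeasurePreserving T μ μ →
      ∀ A : Set X, MeasurableSet A → 0 < μ A →
        0 < Filter.limsup (fun d : ℤ => μ (A ∩ ⇑(T.toEquiv ^ d) '' A))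
          (Filter.cofinite ⊓ Filter.principal D)

/-- The upper density of a set of natural numbers. -/
noncomputable def upperDensity (E : Set ℕ) : ℝ :=
  Filter.limsup (fun N : ℕ => (Set.ncard (E ∩ Set.Icc 1 N) : ℝ) / (N : ℝ)) Filter.atTop

open ProbabilityTheory
open scoped BoundedContinuousFunction

/-- Averages along a finite piece of a sequence are integrals against its empirical measure. -/
lemma exists_empirical_measure {X : Type*} [TopologicalSpace X] [MeasurableSpace X]
    [OpensMeasurableSpace X] (y : ℕ → X) (N : ℕ) :
    ∃ p : ProbabilityMeasure X, 0 < N → ∀ f : X →ᵇ ℝ,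
      ∫ x, f x ∂(p : Measure X) = (1 / (N : ℝ)) * ∑ n ∈ Finset.Icc 1 N, f (y n) := by
  rcases Nat.eq_zero_or_pos N with rfl | hN
  · exact ⟨⟨Measure.dirac (y 0), inferInstance⟩, fun h => absurd h (lt_irrefl _)⟩
  · refine ⟨⟨(N : ENNReal)⁻¹ • ∑ n ∈ Finset.Icc 1 N, Measure.dirac (y n), ⟨?_⟩⟩, fun _ f => ?_⟩
    · simp only [Measure.smul_apply, Measure.finsetSum_apply, measure_univ, smul_eq_mul,
        sum_const, Nat.card_Icc, nsmul_eq_mul, mul_one, Nat.add_sub_cancel]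
      exact ENNReal.inv_mul_cancel (by exact_mod_cast hN.ne') (by simp)
    · have hf : StronglyMeasurable f := f.continuous.measurable.stronglyMeasurable
      change ∫ x, f x ∂((N : ENNReal)⁻¹ • ∑ n ∈ Finset.Icc 1 N, Measure.dirac (y n)) = _
      rw [integral_smul_measure, integral_finsetSum_measure (fun i _ => f.integrable _)]
      simp [integral_dirac' _ _ hf]

/-- **Krylov–Bogoliubov** along an ultrafilter: orbit averages converge to the integral against
an invariant probability measure. -/
lemma exists_invariant_measure_tendsto {X : Type*} [TopologicalSpace X] [MeasurableSpace X]
    [BorelSpace X] [CompactSpace X] [T2Space X] [SecondCountableTopology X]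
    (T : X → X) (hT : Continuous T) (x : X) (U : Ultrafilter ℕ) (hU : (U : Filter ℕ) ≤ atTop) :
    ∃ μ : Measure X, IsProbabilityMeasure μ ∧ MeasurePreserving T μ μ ∧
      ∀ f : X → ℝ, Continuous f →
        Tendsto (fun N : ℕ => (1 / (N : ℝ)) * ∑ n ∈ Finset.Icc 1 N, f (T^[n] x)) U
          (nhds (∫ y, f y ∂μ)) := by
  choose p hp using exists_empirical_measure (fun n => T^[n] x)
  obtain ⟨μ, hμ⟩ : ∃ μ, Tendsto p U (nhds μ) := ⟨_, (U.map p).le_nhds_lim⟩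
  have hlim : ∀ f : X →ᵇ ℝ,
      Tendsto (fun N : ℕ => (1 / (N : ℝ)) * ∑ n ∈ Finset.Icc 1 N, f (T^[n] x)) U
          (nhds (∫ y, f y ∂(μ : Measure X))) := by
    intro f
    refine (ProbabilityMeasure.tendsto_iff_forall_integral_tendsto.1 hμ f).congr' ?_
    filter_upwards [hU (eventually_gt_atTop 0)] with N hN using hp N hN f
  refine ⟨μ, inferInstance, ⟨hT.measurable, ?_⟩, fun f hf =>
    hlim (BoundedContinuousFunction.mkOfCompact ⟨f, hf⟩)⟩
  have := Measure.isProbabilityMeasure_map (μ := (μ : Measure X)) hT.measurable.aemeasurable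
  refine ext_of_forall_integral_eq_of_IsFiniteMeasure fun f => ?_
  rw [integral_map hT.measurable.aemeasurable f.continuous.measurable.aestronglyMeasurable]
  have h1 := hlim (f.compContinuous ⟨T, hT⟩)
  have h2 := hlim f
  have h3 : Tendsto (fun N : ℕ => (1 / (N : ℝ)) * (f (T^[N + 1] x) - f (T^[1] x))) atTop
      (nhds 0) := by
    refine squeeze_zero_norm (a := fun N : ℕ => (1 / (N : ℝ)) * (2 * ‖f‖)) (fun N => ?_) ?_
    · rw [norm_mul, Real.norm_of_nonneg (by positivity : (0 : ℝ) ≤ 1 / (N : ℝ))]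
      gcongr
      linarith [norm_sub_le (f (T^[N + 1] x)) (f (T^[1] x)), f.norm_coe_le_norm (T^[N + 1] x),
        f.norm_coe_le_norm (T^[1] x)]
    · simpa using tendsto_one_div_atTop_nhds_zero_nat.mul_const (2 * ‖f‖)
  refine tendsto_nhds_unique h1 ?_
  have h4 := h2.add (h3.mono_left hU)
  rw [add_zero] at h4
  refine h4.congr fun N => ?_
  rw [← mul_add]
  congr 1
  induction N with
  | zero => simp
  | succ N ih =>
    rw [sum_Icc_succ_top (by omega), sum_Icc_succ_top (by omega), ← ih]
    simp only [BoundedContinuousFunction.compContinuous_apply, ContinuousMap.coe_mk,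
      ← Function.iterate_succ_apply' T]
    ring

lemma card_sqrt_fiber_le (N k : ℕ) :
    #{m ∈ range N | Nat.sqrt m = k} ≤ 2 * k + 1 := by
  have : ({m ∈ range N | Nat.sqrt m = k} : Finset ℕ) ⊆ Finset.Ico (k * k) ((k + 1) * (k + 1)) := by
    intro m hm
    simp only [mem_filter, Finset.mem_range] at hm
    rw [Finset.mem_Ico, ← hm.2]
    exact ⟨Nat.sqrt_le m, Nat.lt_succ_sqrt m⟩
  refine (card_le_card this).trans ?_
  rw [Nat.card_Ico]
  apply Nat.sub_le_iff_le_add.2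
  nlinarith

/-- Second moment bound for sums of bounded centered functions of independent samples, where the
sample is renewed at every square. -/
lemma integral_sq_sum_sqrt_le {X : Type*} [MeasurableSpace X] (μ : Measure X)
    [IsProbabilityMeasure μ] (Y : ℕ → X → ℝ) (hY : ∀ n, Measurable (Y n))
    (hb : ∀ n x, |Y n x| ≤ 1) (h0 : ∀ n, ∫ x, Y n x ∂μ = 0) (N : ℕ) :
    ∫ ω, (∑ n ∈ range N, Y n (ω (Nat.sqrt n))) ^ 2 ∂(Measure.infinitePi fun _ : ℕ => μ)
      ≤ N * (2 * Nat.sqrt N + 1) := by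
  set P := Measure.infinitePi fun _ : ℕ => μ
  have hm : ∀ n, Measurable fun ω : ℕ → X => Y n (ω (Nat.sqrt n)) := fun n =>
    (hY n).comp (measurable_pi_apply _)
  have h_int : ∀ n m, Integrable
      (fun ω : ℕ → X => Y n (ω (Nat.sqrt n)) * Y m (ω (Nat.sqrt m))) P := fun n m =>
    Integrable.of_bound ((hm n).mul (hm m)).aestronglyMeasurable 1 (ae_of_all _ fun ω => by
      rw [norm_mul]
      exact mul_le_one₀ (hb _ _) (norm_nonneg _) (hb _ _))
  have hcov : ∀ n m, ∫ ω, Y n (ω (Nat.sqrt n)) * Y m (ω (Nat.sqrt m)) ∂P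
      ≤ if Nat.sqrt m = Nat.sqrt n then 1 else 0 := by
    intro n m
    split_ifs with h
    · have : ∫ ω, Y n (ω (Nat.sqrt n)) * Y m (ω (Nat.sqrt m)) ∂P ≤ ∫ _, (1 : ℝ) ∂P :=
        integral_mono (h_int n m) (integrable_const _) fun ω => by
          refine (le_abs_self _).trans ?_
          rw [abs_mul]
          exact mul_le_one₀ (hb _ _) (abs_nonneg _) (hb _ _)
      simpa using this
    · have hind := iIndepFun_infinitePi (P := fun _ : ℕ => μ) (X := fun _ => id)
        (fun _ => measurable_id)
      have h1 := ((hind.indepFun (Ne.symm h)).comp (hY n) (hY m)).integral_fun_mul_eq_mul_integral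
        (hm n).aestronglyMeasurable (hm m).aestronglyMeasurable
      have h2 : ∫ ω, Y n (ω (Nat.sqrt n)) ∂P = 0 := by
        rw [← h0 n, ← (measurePreserving_eval_infinitePi (fun _ : ℕ => μ) (Nat.sqrt n)).map_eq,
          integral_map (measurable_pi_apply _).aemeasurable (hY n).aestronglyMeasurable]
      have h3 : ∫ ω, Y n (ω (Nat.sqrt n)) * Y m (ω (Nat.sqrt m)) ∂P
        = (∫ ω, Y n (ω (Nat.sqrt n)) ∂P) * ∫ ω, Y m (ω (Nat.sqrt m)) ∂P := h1
      rw [h3, h2, zero_mul]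
  simp_rw [sq, sum_mul_sum]
  rw [integral_finsetSum _ fun n _ => integrable_finsetSum _ fun m _ => h_int n m]
  calc ∑ n ∈ range N, ∫ ω, ∑ m ∈ range N, Y n (ω (Nat.sqrt n)) * Y m (ω (Nat.sqrt m)) ∂P
      ≤ ∑ n ∈ range N, ((2 * Nat.sqrt N + 1 : ℕ) : ℝ) := by
        refine sum_le_sum fun n hn => ?_
        rw [integral_finsetSum _ fun m _ => h_int n m]
        refine (sum_le_sum fun m _ => hcov n m).trans ?_
        rw [← sum_filter, sum_const, nsmul_eq_mul, mul_one, Nat.cast_le]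
        refine (card_sqrt_fiber_le N _).trans ?_
        have := Nat.sqrt_le_sqrt (Finset.mem_range.1 hn).le
        omega
    _ = N * (2 * Nat.sqrt N + 1) := by
        rw [sum_const, card_range, nsmul_eq_mul]; push_cast; ring

/-- A sequence of functions with summable nonnegative integrals tends to zero almost everywhere. -/
lemma ae_tendsto_zero_of_summable_integral {Ω : Type*} [MeasurableSpace Ω] {P : Measure Ω}
    (f : ℕ → Ω → ℝ) (hf : ∀ n, Integrable (f n) P) (h0 : ∀ n ω, 0 ≤ f n ω)
    (hs : Summable fun n => ∫ ω, f n ω ∂P) :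
    ∀ᵐ ω ∂P, Tendsto (fun n => f n ω) atTop (nhds 0) := by
  have h1 : ∫⁻ ω, ∑' n, ENNReal.ofReal (f n ω) ∂P ≠ ⊤ := by
    rw [lintegral_tsum fun n => (hf n).aemeasurable.ennreal_ofReal]
    simp_rw [← fun n => ofReal_integral_eq_lintegral_ofReal (hf n) (ae_of_all _ (h0 n))]
    exact hs.tsum_ofReal_ne_top
  filter_upwards [ae_lt_top' (AEMeasurable.tsum
    fun n => (hf n).aemeasurable.ennreal_ofReal) h1] with ω hω
  have h2 := ENNReal.tendsto_atTop_zero_of_tsum_ne_top hω.ne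
  have h3 := (ENNReal.tendsto_toReal ENNReal.zero_ne_top).comp h2
  simpa [Function.comp_def, ENNReal.toReal_ofReal, h0] using h3

/-- **Law of large numbers** for functions with a common mean of independent samples, where the
sample is renewed at every square. -/
lemma ae_tendsto_avg_sqrt {X : Type*} [MeasurableSpace X] (μ : Measure X)
    [IsProbabilityMeasure μ] (g : ℕ → X → ℝ) (hg : ∀ n, Measurable (g n))
    (h0 : ∀ n x, 0 ≤ g n x) (h1 : ∀ n x, g n x ≤ 1) (c : ℝ) (hc : ∀ n, ∫ x, g n x ∂μ = c) :
    ∀ᵐ ω ∂(Measure.infinitePi fun _ : ℕ => μ),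
      Tendsto (fun N : ℕ => (∑ n ∈ range N, g n (ω (Nat.sqrt n))) / (N : ℝ)) atTop (nhds c) := by
  set P := Measure.infinitePi fun _ : ℕ => μ
  have hgi : ∀ n, Integrable (g n) μ := fun n =>
    Integrable.of_bound (hg n).aestronglyMeasurable 1 (ae_of_all _ fun x => by
      rw [Real.norm_of_nonneg (h0 n x)]; exact h1 n x)
  have hc0 : 0 ≤ c := hc 0 ▸ integral_nonneg (h0 0)
  have hc1 : c ≤ 1 := by
    have := integral_mono (hgi 0) (integrable_const (1 : ℝ)) (h1 0)
    simpa [hc 0] using this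
  set Y : ℕ → X → ℝ := fun n x => g n x - c with hYdef
  have hY : ∀ n, Measurable (Y n) := fun n => (hg n).sub_const c
  have hb : ∀ n x, |Y n x| ≤ 1 := fun n x => by
    rw [abs_le]; constructor <;> simp only [hYdef] <;> linarith [h0 n x, h1 n x]
  have hY0 : ∀ n, ∫ x, Y n x ∂μ = 0 := fun n => by
    simp only [hYdef]
    rw [integral_sub (hgi n) (integrable_const _), hc n]; simp
  have hm : ∀ n, Measurable fun ω : ℕ → X => Y n (ω (Nat.sqrt n)) := fun n =>
    (hY n).comp (measurable_pi_apply _)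
  have hsm : ∀ N, Measurable fun ω : ℕ → X => ∑ n ∈ range N, Y n (ω (Nat.sqrt n)) := fun N =>
    Finset.measurable_sum _ fun n _ => hm n
  have hsb : ∀ N (ω : ℕ → X), |∑ n ∈ range N, Y n (ω (Nat.sqrt n))| ≤ N := fun N ω => by
    refine (abs_sum_le_sum_abs _ _).trans ((sum_le_sum fun n _ => hb n _).trans ?_)
    simp
  have key := ae_tendsto_zero_of_summable_integral (P := P)
    (fun (j : ℕ) ω => ((∑ n ∈ range (j ^ 4), Y n (ω (Nat.sqrt n))) / ((j ^ 4 : ℕ) : ℝ)) ^ 2)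
    (fun j => Integrable.of_bound (((hsm _).div_const _).pow_const 2).aestronglyMeasurable 1
      (ae_of_all _ fun ω => by
        rw [norm_pow, norm_div, Real.norm_eq_abs, Real.norm_eq_abs, Nat.abs_cast]
        exact pow_le_one₀ (by positivity) (div_le_one_of_le₀ (hsb _ ω) (by positivity))))
    (fun j ω => sq_nonneg _)
    (by
      refine Summable.of_nonneg_of_le (fun j => integral_nonneg fun ω => sq_nonneg _) (fun j => ?_)
        ((Real.summable_one_div_nat_pow.2 one_lt_two).mul_left 3)
      simp_rw [div_pow]
      rw [integral_div]
      have hj := integral_sq_sum_sqrt_le μ Y hY hb hY0 (j ^ 4)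
      have hsq : Nat.sqrt (j ^ 4) = j ^ 2 := by
        rw [show j ^ 4 = (j ^ 2) ^ 2 by ring, Nat.sqrt_eq']
      rw [hsq] at hj
      rcases Nat.eq_zero_or_pos j with rfl | hjpos
      · simp
      have hj1 : (1 : ℝ) ≤ j := by exact_mod_cast hjpos
      rw [div_le_iff₀ (by positivity)]
      refine hj.trans ?_
      push_cast
      have : 3 * (1 / (j : ℝ) ^ 2) * ((j : ℝ) ^ 4) ^ 2 = (j : ℝ) ^ 4 * (3 * (j : ℝ) ^ 2) := by
        field_simp
      rw [this]
      gcongr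
      nlinarith)
  filter_upwards [key] with ω hω
  refine tendsto_div_of_monotone_of_exists_subseq_tendsto_div _ c
    (fun a b hab => sum_le_sum_of_subset_of_nonneg (range_mono hab) fun _ _ _ => h0 _ _)
    fun a ha => ⟨fun j => j ^ 4, ?_, tendsto_pow_atTop (by norm_num), ?_⟩
  · have h : Tendsto (fun j : ℕ => (1 + 1 / (j : ℝ)) ^ 4) atTop (nhds 1) := by
      simpa using (tendsto_one_div_atTop_nhds_zero_nat (𝕜 := ℝ)).const_add 1 |>.pow 4
    filter_upwards [h.eventually (gt_mem_nhds ha), eventually_gt_atTop 0] with j hj hj0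
    have hj1 : (0 : ℝ) < j := by exact_mod_cast hj0
    push_cast
    calc ((j : ℝ) + 1) ^ 4 = (1 + 1 / (j : ℝ)) ^ 4 * j ^ 4 := by
          rw [← mul_pow]; congr 1; field_simp
      _ ≤ a * j ^ 4 := by gcongr
  · have h2 : Tendsto (fun j : ℕ => (∑ n ∈ range (j ^ 4), Y n (ω (Nat.sqrt n))) / ((j ^ 4 : ℕ) : ℝ))
        atTop (nhds 0) := by
      have := hω.sqrt
      simp only [Real.sqrt_sq_eq_abs, Real.sqrt_zero] at this
      exact tendsto_zero_iff_abs_tendsto_zero _ |>.2 this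
    have h3 := h2.add_const c
    rw [zero_add] at h3
    refine h3.congr' ?_
    filter_upwards [eventually_gt_atTop 0] with j hj
    have : ((j ^ 4 : ℕ) : ℝ) ≠ 0 := by positivity
    simp only [hYdef, sum_sub_distrib, sum_const, card_range, nsmul_eq_mul]
    field_simp
    ring

lemma tendsto_avg_Icc_of_tendsto_avg_range {h : ℕ → ℝ} (hb : ∀ n, |h n| ≤ 1) {c : ℝ}
    (hc : Tendsto (fun N : ℕ => (∑ n ∈ range N, h n) / (N : ℝ)) atTop (nhds c)) :
    Tendsto (fun N : ℕ => (1 / (N : ℝ)) * ∑ n ∈ Finset.Icc 1 N, h n) atTop (nhds c) := by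
  have h1 : Tendsto (fun N : ℕ => (1 / (N : ℝ)) * (h N - h 0)) atTop (nhds 0) := by
    refine squeeze_zero_norm (a := fun N : ℕ => (1 / (N : ℝ)) * 2) (fun N => ?_) ?_
    · rw [norm_mul, Real.norm_of_nonneg (by positivity : (0 : ℝ) ≤ 1 / (N : ℝ))]
      gcongr
      refine (abs_sub _ _).trans ?_
      linarith [hb N, hb 0]
    · simpa using tendsto_one_div_atTop_nhds_zero_nat.mul_const (2 : ℝ)
  have h2 := hc.add h1
  rw [add_zero] at h2
  refine h2.congr fun N => ?_
  rw [div_eq_inv_mul, ← one_div, ← mul_add]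
  congr 1
  rw [← add_sub_assoc, ← sum_range_succ, sum_range_succ', add_sub_cancel_right,
    range_eq_Ico, sum_Ico_add' h 0 N 1]
  rfl

lemma sum_range_shift_sub_le {t : ℕ → ℝ} (ht : Monotone t) (h0 : ∀ n, 0 ≤ t n) (N k : ℕ) :
    ∑ n ∈ range N, (t (n + k) - t n) ≤ k * t (N + k) := by
  induction k with
  | zero => simp
  | succ k ih =>
    have h1 : ∑ n ∈ range N, (t (n + (k + 1)) - t (n + k)) = t (N + k) - t k := by
      have := sum_range_sub (fun n => t (n + k)) N
      simp only [zero_add] at this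
      rw [← this]
      exact sum_congr rfl fun n _ => by congr 2; ring
    have h2 : ∑ n ∈ range N, (t (n + (k + 1)) - t n)
        = ∑ n ∈ range N, (t (n + (k + 1)) - t (n + k)) + ∑ n ∈ range N, (t (n + k) - t n) := by
      rw [← sum_add_distrib]; exact sum_congr rfl fun n _ => by ring
    have h3 := ht (show N + k ≤ N + (k + 1) by omega)
    have h4 : (k : ℝ) * t (N + k) ≤ k * t (N + (k + 1)) := by gcongr
    rw [h2, h1]
    push_cast
    linarith [h0 k]

/-- A fixed shift changes the integer square root only on a set of density zero. -/
lemma tendsto_avg_sqrt_shift_ne (d : ℤ) :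
    Tendsto (fun N : ℕ => (∑ n ∈ range N,
      if (n : ℤ) + d < 0 ∨ Nat.sqrt ((n : ℤ) + d).toNat ≠ Nat.sqrt n then (1 : ℝ) else 0) / (N : ℝ))
      atTop (nhds 0) := by
  set D := d.natAbs with hD
  set t : ℕ → ℝ := fun m => (Nat.sqrt (m - D) : ℝ) with ht
  have htm : Monotone t := fun a b hab =>
    Nat.cast_le.2 (Nat.sqrt_le_sqrt (Nat.sub_le_sub_right hab D))
  have hle : ∀ n : ℕ, (if (n : ℤ) + d < 0 ∨ Nat.sqrt ((n : ℤ) + d).toNat ≠ Nat.sqrt n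
      then (1 : ℝ) else 0) ≤ t (n + 2 * D) - t n := by
    intro n
    have hup : n + 2 * D - D = n + D := by omega
    simp only [ht, hup]
    have hmono : Nat.sqrt (n - D) ≤ Nat.sqrt (n + D) := Nat.sqrt_le_sqrt (by omega)
    split_ifs with h
    · have : Nat.sqrt (n - D) + 1 ≤ Nat.sqrt (n + D) := by
        rcases h with h | h
        · have h1 : n - D = 0 := by omega
          have h2 : 0 < Nat.sqrt (n + D) := Nat.sqrt_pos.2 (by omega)
          rw [h1, Nat.sqrt_zero]; omega
        · have h1 : Nat.sqrt (n - D) ≤ Nat.sqrt n := Nat.sqrt_le_sqrt (by omega)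
          have h2 : Nat.sqrt n ≤ Nat.sqrt (n + D) := Nat.sqrt_le_sqrt (by omega)
          have h3 : Nat.sqrt (n - D) ≤ Nat.sqrt ((n : ℤ) + d).toNat := Nat.sqrt_le_sqrt (by omega)
          have h4 : Nat.sqrt ((n : ℤ) + d).toNat ≤ Nat.sqrt (n + D) := Nat.sqrt_le_sqrt (by omega)
          omega
      have : ((Nat.sqrt (n - D) + 1 : ℕ) : ℝ) ≤ Nat.sqrt (n + D) := Nat.cast_le.2 this
      push_cast at this
      linarith
    · have : (Nat.sqrt (n - D) : ℝ) ≤ Nat.sqrt (n + D) := Nat.cast_le.2 hmono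
      linarith
  have hbound : Tendsto (fun N : ℕ => (2 * D : ℝ) * 2 * (√(N : ℝ))⁻¹) atTop (nhds 0) := by
    have := (tendsto_inv_atTop_zero.comp
      (Real.tendsto_sqrt_atTop.comp (tendsto_natCast_atTop_atTop (R := ℝ)))).const_mul
        ((2 * D : ℝ) * 2)
    simpa using this
  refine squeeze_zero' (Eventually.of_forall fun N => by positivity) ?_ hbound
  filter_upwards [eventually_ge_atTop D, eventually_gt_atTop 0] with N hN hN0
  have hNpos : (0 : ℝ) < N := by exact_mod_cast hN0
  rw [div_le_iff₀ hNpos]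
  refine (sum_le_sum fun n _ => hle n).trans
    ((sum_range_shift_sub_le htm (fun n => Nat.cast_nonneg _) N (2 * D)).trans ?_)
  have h1 : t (N + 2 * D) ≤ 2 * √(N : ℝ) := by
    have h2 : t (N + 2 * D) ≤ √((N + D : ℕ) : ℝ) := by
      simp only [ht]
      rw [show N + 2 * D - D = N + D by omega]
      exact Real.nat_sqrt_le_real_sqrt
    refine h2.trans ?_
    rw [Real.sqrt_le_left (by positivity), mul_pow, Real.sq_sqrt hNpos.le]
    have : ((N + D : ℕ) : ℝ) ≤ ((N + N : ℕ) : ℝ) := Nat.cast_le.2 (by omega)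
    push_cast at this ⊢
    linarith
  have h3 : (√(N : ℝ))⁻¹ * N = √(N : ℝ) := by
    rw [inv_mul_eq_div, Real.div_sqrt]
  rw [mul_assoc _ _ (N : ℝ), h3]
  push_cast
  calc 2 * (D : ℝ) * t (N + 2 * D) ≤ 2 * D * (2 * √(N : ℝ)) := by gcongr
    _ = _ := by ring

lemma measurePreserving_zpow {X : Type*} [MeasurableSpace X] {μ : Measure X} {T : X ≃ᵐ X}
    (hT : MeasurePreserving T μ μ) (k : ℤ) : MeasurePreserving ⇑(T.toEquiv ^ k) μ μ := by
  induction k using Int.induction_on with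
  | zero => exact MeasurePreserving.id μ
  | succ k ih => rw [zpow_add_one]; exact ih.comp hT
  | pred k ih => rw [zpow_sub_one]; exact ih.comp (MeasurePreserving.symm T hT)

/-- **Inverse correspondence principle**: the return measures of a set in a measure-preserving
system are the correlations of a 0-1 sequence supported on the naturals. -/
lemma exists_sequence_tendsto_correlation {X : Type*} [MeasurableSpace X] (μ : Measure X)
    [IsProbabilityMeasure μ] (T : X ≃ᵐ X) (hT : MeasurePreserving T μ μ) (A : Set X)
    (hA : MeasurableSet A) :
    ∃ u : ℤ → ℝ, (∀ n, u n = 0 ∨ u n = 1) ∧ (∀ n < 0, u n = 0) ∧ ∀ d : ℤ,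
      Tendsto (fun N : ℕ => (1 / (N : ℝ)) * ∑ n ∈ Finset.Icc 1 N, u ((n : ℤ) + d) * u (n : ℤ))
        atTop (nhds (μ.real (A ∩ ⇑(T.toEquiv ^ d) '' A))) := by
  classical
  set F : ℤ → X → ℝ := fun k x => if (T.toEquiv ^ k) x ∈ A then 1 else 0 with hF
  have hT' := measurePreserving_zpow hT
  have hFm : ∀ k, Measurable (F k) := fun k =>
    Measurable.ite ((hT' k).measurable hA) measurable_const measurable_const
  have hF01 : ∀ k x, F k x = 0 ∨ F k x = 1 := fun k x => by
    simp only [hF]; split_ifs <;> simp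
  have hF0 : ∀ k x, 0 ≤ F k x := fun k x => by rcases hF01 k x with h | h <;> simp [h]
  have hF1 : ∀ k x, F k x ≤ 1 := fun k x => by rcases hF01 k x with h | h <;> simp [h]
  have h_int : ∀ (d : ℤ) (n : ℕ), ∫ x, F (n + d) x * F n x ∂μ
      = μ.real (A ∩ ⇑(T.toEquiv ^ d) '' A) := by
    intro d n
    have hB : MeasurableSet (A ∩ ⇑(T.toEquiv ^ d) '' A) := by
      refine hA.inter ?_
      rw [Equiv.image_eq_preimage_symm]
      have := (hT' (-d)).measurable hA
      rwa [zpow_neg] at this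
    have : (fun x => F (n + d) x * F n x)
        = (⇑(T.toEquiv ^ ((n : ℤ) + d)) ⁻¹' (A ∩ ⇑(T.toEquiv ^ d) '' A)).indicator 1 := by
      ext x
      have hx : (T.toEquiv ^ ((n : ℤ) + d)) x ∈ ⇑(T.toEquiv ^ d) '' A ↔
          (T.toEquiv ^ (n : ℤ)) x ∈ A := by
        rw [add_comm, zpow_add, Equiv.Perm.mul_apply, (T.toEquiv ^ d).injective.mem_set_image]
      simp only [hF, Set.indicator_apply, Set.mem_preimage, Set.mem_inter_iff, hx, Pi.one_apply]
      split_ifs <;> simp_all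
    rw [this, integral_indicator_one ((hT' _).measurable hB),
      (hT' _).measureReal_preimage hB.nullMeasurableSet]
  have hae : ∀ᵐ ω ∂(Measure.infinitePi fun _ : ℕ => μ), ∀ d : ℤ,
      Tendsto (fun N : ℕ => (∑ n ∈ range N, F (n + d) (ω (Nat.sqrt n)) * F n (ω (Nat.sqrt n)))
        / (N : ℝ)) atTop (nhds (μ.real (A ∩ ⇑(T.toEquiv ^ d) '' A))) := by
    rw [ae_all_iff]
    intro d
    exact ae_tendsto_avg_sqrt μ (fun n x => F (n + d) x * F n x) (fun n => (hFm _).mul (hFm _))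
      (fun n x => mul_nonneg (hF0 _ _) (hF0 _ _))
      (fun n x => mul_le_one₀ (hF1 _ _) (hF0 _ _) (hF1 _ _)) _ (h_int d)
  obtain ⟨ω, hω⟩ := hae.exists
  set u : ℤ → ℝ := fun k => if k < 0 then 0 else F k (ω (Nat.sqrt k.toNat)) with hu
  have hu01 : ∀ k, u k = 0 ∨ u k = 1 := fun k => by
    simp only [hu]
    split_ifs
    · exact Or.inl rfl
    · exact hF01 _ _
  refine ⟨u, hu01, fun n hn => by simp [hu, hn], fun d => ?_⟩
  refine tendsto_avg_Icc_of_tendsto_avg_range (h := fun n : ℕ => u (n + d) * u n) (fun n => ?_) ?_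
  · rcases hu01 (n + d) with h | h <;> rcases hu01 n with h' | h' <;> simp [h, h']
  · have hdiff : Tendsto (fun N : ℕ => (∑ n ∈ range N, u (n + d) * u n) / (N : ℝ) -
        (∑ n ∈ range N, F (n + d) (ω (Nat.sqrt n)) * F n (ω (Nat.sqrt n))) / (N : ℝ))
        atTop (nhds 0) := by
      refine squeeze_zero_norm (fun N => ?_) (tendsto_avg_sqrt_shift_ne d)
      rw [← sub_div, ← sum_sub_distrib, norm_div, Real.norm_natCast]
      gcongr
      refine (norm_sum_le _ _).trans (sum_le_sum fun n _ => ?_)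
      have hn : u n = F n (ω (Nat.sqrt n)) := by simp [hu]
      rw [hn]
      split_ifs with h
      · rw [← sub_mul, norm_mul]
        have a1 : ‖u (n + d) - F (n + d) (ω (Nat.sqrt n))‖ ≤ 1 := by
          rcases hu01 (n + d) with h | h <;> rcases hF01 (n + d) (ω (Nat.sqrt n)) with h' | h' <;>
            simp [h, h']
        have a2 : ‖F n (ω (Nat.sqrt n))‖ ≤ 1 := by
          rw [Real.norm_of_nonneg (hF0 _ _)]; exact hF1 _ _
        exact mul_le_one₀ a1 (norm_nonneg _) a2
      · push Not at h
        have : u (n + d) = F (n + d) (ω (Nat.sqrt n)) := by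
          simp only [hu]
          rw [if_neg (not_lt.2 h.1), h.2]
        rw [this, sub_self, norm_zero]
    simpa using hdiff.add (hω d)

/-- The upper correlation `limsup_N (1/N) ∑_{n=1}^N u(n+d) u(n)`. -/
noncomputable def upperCorrelation (u : ℤ → ℝ) (d : ℤ) : ℝ :=
  Filter.limsup (fun N : ℕ => (1 / (N : ℝ)) * ∑ n ∈ Finset.Icc 1 N, u ((n : ℤ) + d) * u (n : ℤ))
    Filter.atTop

lemma avg_mem_Icc {h : ℕ → ℝ} (h0 : ∀ n, 0 ≤ h n) (h1 : ∀ n, h n ≤ 1) (N : ℕ) :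
    (1 / (N : ℝ)) * ∑ n ∈ Finset.Icc 1 N, h n ∈ Set.Icc (0 : ℝ) 1 := by
  refine ⟨mul_nonneg (by positivity) (sum_nonneg fun n _ => h0 n), ?_⟩
  have : ∑ n ∈ Finset.Icc 1 N, h n ≤ N := by
    refine (sum_le_sum fun n _ => h1 n).trans ?_
    simp
  rw [one_div, inv_mul_eq_div]
  exact div_le_one_of_le₀ this (by positivity)

lemma isBoundedUnder_le_of_mem_Icc {ι : Type*} {v : ι → ℝ} (hv : ∀ N, v N ∈ Set.Icc (0 : ℝ) 1)
    (F : Filter ι) : IsBoundedUnder (· ≤ ·) F v :=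
  isBoundedUnder_of ⟨1, fun N => (hv N).2⟩

lemma isCoboundedUnder_le_of_mem_Icc {ι : Type*} {v : ι → ℝ}
    (hv : ∀ N, v N ∈ Set.Icc (0 : ℝ) 1) (F : Filter ι) [F.NeBot] :
    IsCoboundedUnder (· ≤ ·) F v :=
  (isBoundedUnder_of (r := (· ≥ ·)) ⟨0, fun N => (hv N).1⟩).isCoboundedUnder_le

lemma le_limsup_of_tendsto_ultrafilter {v : ℕ → ℝ} (hv : ∀ N, v N ∈ Set.Icc (0 : ℝ) 1)
    {U : Ultrafilter ℕ} (hU : (U : Filter ℕ) ≤ atTop) {l : ℝ} (hl : Tendsto v U (nhds l)) :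
    l ≤ limsup v atTop := by
  rw [← hl.limsup_eq]
  exact limsup_le_limsup_of_le hU (isCoboundedUnder_le_of_mem_Icc hv _)
    (isBoundedUnder_le_of_mem_Icc hv _)

/-- The left shift on the full shift over `B`. -/
def shiftEquiv (B : Type*) [MeasurableSpace B] : (ℤ → B) ≃ᵐ (ℤ → B) where
  toFun y k := y (k + 1)
  invFun y k := y (k - 1)
  left_inv y := by ext k; simp
  right_inv y := by ext k; simp
  measurable_toFun := measurable_pi_iff.2 fun k => measurable_pi_apply (k + 1)
  measurable_invFun := measurable_pi_iff.2 fun k => measurable_pi_apply (k - 1)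

lemma shiftEquiv_zpow_apply {B : Type*} [MeasurableSpace B] (d : ℤ) (y : ℤ → B) (k : ℤ) :
    ((shiftEquiv B).toEquiv ^ d) y k = y (k + d) := by
  induction d using Int.induction_on generalizing y with
  | zero => simp
  | succ d ih =>
    rw [zpow_add_one, Equiv.Perm.mul_apply, ih]
    exact congrArg y (by ring)
  | pred d ih =>
    rw [zpow_sub_one, Equiv.Perm.mul_apply, ih]
    exact congrArg y (by ring)

lemma shiftEquiv_iterate_apply {B : Type*} [MeasurableSpace B] (n : ℕ) (y : ℤ → B) (k : ℤ) :
    (shiftEquiv B)^[n] y k = y (k + n) := by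
  induction n generalizing y with
  | zero => simp
  | succ n ih =>
    rw [Function.iterate_succ_apply, ih]
    exact congrArg y (by push_cast; ring)

/-- **Furstenberg correspondence principle** for sets of strong recurrence. -/
lemma IsStrongRecurrenceSet.exists_infinite_lt_upperCorrelation.{v} {D : Set ℤ}
    (hD : IsStrongRecurrenceSet.{v} D) (u : ℤ → ℝ) (hu : ∀ n, u n = 0 ∨ u n = 1) {δ : ℝ}
    (hδ : 0 < δ) (hfreq : ∃ᶠ N : ℕ in atTop, δ < (1 / (N : ℝ)) * ∑ n ∈ Finset.Icc 1 N, u (n : ℤ)) :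
    ∃ ε : ℝ, 0 < ε ∧
      {d : ℤ | d ∈ D ∧ ε < upperCorrelation u d ∧ ε < upperCorrelation u (-d)}.Infinite := by
  classical
  let B := ULift.{v} Bool
  obtain ⟨U, hU, hUδ⟩ : ∃ U : Ultrafilter ℕ, (U : Filter ℕ) ≤ atTop ∧
      ∀ᶠ N : ℕ in (U : Filter ℕ), δ < (1 / (N : ℝ)) * ∑ n ∈ Finset.Icc 1 N, u (n : ℤ) := by
    have := frequently_iff_neBot.1 hfreq
    have hle := Ultrafilter.of_le (atTop ⊓ 𝓟 {N : ℕ |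
      δ < (1 / (N : ℝ)) * ∑ n ∈ Finset.Icc 1 N, u (n : ℤ)})
    exact ⟨Ultrafilter.of _, hle.trans inf_le_left, hle.trans inf_le_right (mem_principal_self _)⟩
  let x : ℤ → B := fun k => ULift.up (decide (u k = 1))
  have hcont : Continuous (shiftEquiv B) :=
    continuous_pi fun k => continuous_apply (k + 1)
  obtain ⟨μ, hμ, hT, hlim⟩ := exists_invariant_measure_tendsto (shiftEquiv B) hcont x U hU
  let A : Set (ℤ → B) := {y | (y 0).down = true}
  let C : ℤ → Set (ℤ → B) := fun d => {y | (y 0).down = true ∧ (y d).down = true}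
  have hCclopen : ∀ d, IsClopen (C d) := fun d =>
    (isClopen_discrete {p : B × B | p.1.down = true ∧ p.2.down = true}).preimage
      (f := fun y : ℤ → B => (y 0, y d)) ((continuous_apply (0 : ℤ)).prodMk (continuous_apply d))
  have hCmeas : ∀ d, MeasurableSet (C d) := fun d => (hCclopen d).isClosed.measurableSet
  have hClim : ∀ d, Tendsto (fun N : ℕ => (1 / (N : ℝ)) * ∑ n ∈ Finset.Icc 1 N,
      u ((n : ℤ) + d) * u (n : ℤ)) U (nhds (μ.real (C d))) := by
    intro d
    have := hlim ((C d).indicator 1) ((hCclopen d).continuous_indicator continuous_one)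
    rw [integral_indicator_one (hCmeas d)] at this
    refine this.congr fun N => ?_
    congr 1
    refine sum_congr rfl fun n _ => ?_
    simp only [Set.indicator_apply, C, Set.mem_ofPred_eq, shiftEquiv_iterate_apply, x,
      decide_eq_true_eq, Pi.one_apply, zero_add]
    rw [add_comm d]
    rcases hu n with h | h <;> rcases hu (n + d) with h' | h' <;> simp [h, h']
  have hCle : ∀ d, μ.real (C d) ≤ upperCorrelation u d := fun d =>
    le_limsup_of_tendsto_ultrafilter (fun N => avg_mem_Icc
      (fun n => by rcases hu n with h | h <;> rcases hu (n + d) with h' | h' <;> simp [h, h'])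
      (fun n => by rcases hu n with h | h <;> rcases hu (n + d) with h' | h' <;> simp [h, h']) N)
      hU (hClim d)
  have hAC : A = C 0 := by ext y; simp [A, C]
  have himage : ∀ d : ℤ, A ∩ ⇑((shiftEquiv B).toEquiv ^ d) '' A = C (-d) := by
    intro d
    ext y
    rw [Equiv.image_eq_preimage_symm, ← Equiv.Perm.inv_def, ← zpow_neg]
    simp only [A, C, Set.mem_inter_iff, Set.mem_preimage, Set.mem_ofPred_eq,
      shiftEquiv_zpow_apply, zero_add]
  have hneg : ∀ d, μ (C (-d)) = μ (C d) := by
    intro d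
    rw [← (measurePreserving_zpow hT d).measure_preimage (hCmeas (-d)).nullMeasurableSet]
    congr 1
    ext y
    simp only [C, Set.mem_preimage, Set.mem_ofPred_eq, shiftEquiv_zpow_apply, zero_add,
      neg_add_cancel]
    exact and_comm
  have hApos : 0 < μ A := by
    have h1 : δ ≤ μ.real (C 0) := by
      refine ge_of_tendsto (hClim 0) ?_
      filter_upwards [hUδ] with N hN
      refine hN.le.trans_eq ?_
      congr 1
      refine sum_congr rfl fun n _ => ?_
      rw [add_zero]
      rcases hu n with h | h <;> simp [h]
    rw [hAC]
    exact (ENNReal.toReal_pos_iff.1 (hδ.trans_le h1)).1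
  have hrec := hD (ℤ → B) inferInstance μ hμ (shiftEquiv B) hT A (hAC ▸ hCmeas 0) hApos
  obtain ⟨ε, hε0, hε⟩ := exists_between hrec
  have hfr := frequently_lt_of_lt_limsup (by isBoundedDefault) hε
  rw [frequently_inf_principal, frequently_cofinite_iff_infinite] at hfr
  have hεtop : ε ≠ ⊤ := hε.ne_top
  refine ⟨ε.toReal, ENNReal.toReal_pos hε0.ne' hεtop, hfr.mono ?_⟩
  rintro d ⟨hdD, hd⟩
  rw [himage] at hd
  have hd1 : ε.toReal < μ.real (C (-d)) := (ENNReal.toReal_lt_toReal hεtop (measure_ne_top _ _)).2 hd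
  have hd2 : ε.toReal < μ.real (C d) := by rw [measureReal_def, ← hneg]; exact hd1
  exact ⟨hdD, hd2.trans_le (hCle d), hd1.trans_le (hCle (-d))⟩

lemma upperDensity_eq_limsup_avg {S : Set ℕ} {h : ℕ → ℝ} (h1 : ∀ n ∈ S, h n = 1)
    (h0 : ∀ n ∉ S, h n = 0) :
    upperDensity S = limsup (fun N : ℕ => (1 / (N : ℝ)) * ∑ n ∈ Finset.Icc 1 N, h n) atTop := by
  classical
  unfold upperDensity
  congr 1
  ext N
  have hS : S ∩ Set.Icc 1 N = ↑({n ∈ Finset.Icc 1 N | n ∈ S} : Finset ℕ) := by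
    ext n; simp; tauto
  have hsum : ∑ n ∈ Finset.Icc 1 N, h n = #{n ∈ Finset.Icc 1 N | n ∈ S} := by
    rw [card_filter, Nat.cast_sum]
    refine sum_congr rfl fun n _ => ?_
    split_ifs with hn
    · simp [h1 n hn]
    · simp [h0 n hn]
  rw [hS, Set.ncard_coe_finset, hsum, one_div, inv_mul_eq_div]

lemma upperDensity_inter_shift_eq {u : ℤ → ℝ} (hu : ∀ n, u n = 0 ∨ u n = 1)
    (hneg : ∀ n < 0, u n = 0) {E : Set ℕ} (hE : ∀ n : ℕ, n ∈ E ↔ u n = 1) (d : ℤ) :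
    upperDensity (E ∩ {n : ℕ | ∃ m ∈ E, (n : ℤ) = (m : ℤ) + d}) = upperCorrelation u (-d) := by
  have hshift : ∀ n : ℕ, (∃ m ∈ E, (n : ℤ) = (m : ℤ) + d) ↔ u (n + -d) = 1 := by
    intro n
    constructor
    · rintro ⟨m, hm, h⟩
      rw [h, add_neg_cancel_right]
      exact (hE m).1 hm
    · intro h
      have hn : 0 ≤ (n : ℤ) + -d := by
        by_contra hlt
        rw [hneg _ (not_le.1 hlt)] at h
        exact zero_ne_one h
      refine ⟨((n : ℤ) + -d).toNat, ?_, ?_⟩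
      · rwa [hE, Int.toNat_of_nonneg hn]
      · rw [Int.toNat_of_nonneg hn]; ring
  refine upperDensity_eq_limsup_avg (fun n hn => ?_) (fun n hn => ?_)
  · rw [(hE n).1 hn.1, (hshift n).1 hn.2, one_mul]
  · by_cases h : n ∈ E
    · have h2 : u (n + -d) ≠ 1 := fun h' => hn ⟨h, (hshift n).2 h'⟩
      rw [(hu _).resolve_right h2, zero_mul]
    · rw [(hu _).resolve_right (fun h' => h ((hE n).2 h')), mul_zero]

/-- A set failing strong recurrence admits a 0-1 sequence of positive density whose correlations
vanish along the set. -/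
lemma exists_sequence_of_not_isStrongRecurrenceSet {D : Set ℤ} (hD : ¬ IsStrongRecurrenceSet D) :
    ∃ u : ℤ → ℝ, (∀ n, u n = 0 ∨ u n = 1) ∧ (∀ n < 0, u n = 0) ∧
      (∃ a : ℝ, 0 < a ∧
        Tendsto (fun N : ℕ => (1 / (N : ℝ)) * ∑ n ∈ Finset.Icc 1 N, u (n : ℤ)) atTop (nhds a)) ∧
      (∀ d, upperCorrelation u (-d) = upperCorrelation u d) ∧
      Tendsto (upperCorrelation u) (cofinite ⊓ 𝓟 D) (nhds 0) := by
  unfold IsStrongRecurrenceSet at hD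
  push Not at hD
  obtain ⟨X, _, μ, hμ, T, hT, A, hA, hApos, hlim⟩ := hD
  obtain ⟨u, hu, hneg, hcorr⟩ := exists_sequence_tendsto_correlation μ T hT A hA
  have hval : ∀ d, upperCorrelation u d = μ.real (A ∩ ⇑(T.toEquiv ^ d) '' A) :=
    fun d => (hcorr d).limsup_eq
  have himage : ∀ d : ℤ, ⇑(T.toEquiv ^ d) '' A = ⇑(T.toEquiv ^ (-d)) ⁻¹' A := fun d => by
    rw [Equiv.image_eq_preimage_symm, ← Equiv.Perm.inv_def, ← zpow_neg]
  have hsymm : ∀ d : ℤ, μ.real (A ∩ ⇑(T.toEquiv ^ (-d)) '' A)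
      = μ.real (A ∩ ⇑(T.toEquiv ^ d) '' A) := by
    intro d
    have hm : MeasurableSet (A ∩ ⇑(T.toEquiv ^ d) '' A) := by
      rw [himage]
      exact hA.inter ((measurePreserving_zpow hT (-d)).measurable hA)
    rw [← (measurePreserving_zpow hT d).measureReal_preimage hm.nullMeasurableSet,
      Set.preimage_inter, Set.preimage_image_eq _ (Equiv.injective _), himage, neg_neg,
      Set.inter_comm]
  refine ⟨u, hu, hneg, ⟨μ.real A, ENNReal.toReal_pos hApos.ne' (measure_ne_top _ _), ?_⟩,
    fun d => by rw [hval, hval, hsymm], ?_⟩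
  · have h := hcorr 0
    simp only [zpow_zero, Equiv.Perm.coe_one, Set.image_id, Set.inter_self, add_zero] at h
    refine h.congr fun N => ?_
    congr 1
    refine sum_congr rfl fun n _ => ?_
    rcases hu n with h | h <;> simp [h]
  · have h : Tendsto (fun d : ℤ => μ (A ∩ ⇑(T.toEquiv ^ d) '' A)) (cofinite ⊓ 𝓟 D) (nhds 0) :=
      tendsto_of_le_liminf_of_limsup_le bot_le hlim
    have h' := (ENNReal.tendsto_toReal ENNReal.zero_ne_top).comp h
    exact h'.congr fun d => (hval d).symm

/-- **Equivalent characterizations of strong recurrence**: (SR1) ↔ (SR2) and (SR1) ↔ (SR3). -/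
theorem stmt_19 (D : Set ℤ) (hD : D.Infinite) :
    (IsStrongRecurrenceSet D ↔
      ∀ E : Set ℕ, 0 < upperDensity E →
        ∃ ε : ℝ, 0 < ε ∧
          {d : ℤ | d ∈ D ∧
            ε < upperDensity (E ∩ {n : ℕ | ∃ m ∈ E, (n : ℤ) = (m : ℤ) + d})}.Infinite) ∧
    (IsStrongRecurrenceSet D ↔
      ∀ u : ℤ → ℝ, (∀ n, u n = 0 ∨ u n = 1) →
        Tendsto (fun d : ℤ =>
            Filter.limsup (fun N : ℕ =>
              (1 / (N : ℝ)) * ∑ n ∈ Finset.Icc 1 N, u ((n : ℤ) + d) * u (n : ℤ))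
            Filter.atTop)
          (Filter.cofinite ⊓ Filter.principal D) (nhds 0) →
        Tendsto (fun N : ℕ => (1 / (N : ℝ)) * ∑ n ∈ Finset.Icc 1 N, u (n : ℤ))
          Filter.atTop (nhds 0)) := by
  classical
  refine ⟨⟨fun h E hE => ?_, fun h => ?_⟩, ⟨fun h u hu hcorr => ?_, fun h => ?_⟩⟩
  · set u : ℤ → ℝ := fun k => if 0 ≤ k ∧ k.toNat ∈ E then 1 else 0 with hudef
    have hu : ∀ n, u n = 0 ∨ u n = 1 := fun n => by simp only [hudef]; split_ifs <;> simp
    have hneg : ∀ n < 0, u n = 0 := fun n hn => if_neg fun h' => absurd h'.1 (not_le.2 hn)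
    have hmem : ∀ n : ℕ, n ∈ E ↔ u n = 1 := fun n => by simp [hudef]
    have hdens : upperDensity E
        = limsup (fun N : ℕ => (1 / (N : ℝ)) * ∑ n ∈ Finset.Icc 1 N, u (n : ℤ)) atTop :=
      upperDensity_eq_limsup_avg (fun n hn => (hmem n).1 hn)
        fun n hn => (hu n).resolve_right fun h' => hn ((hmem n).2 h')
    obtain ⟨δ, hδ0, hδ⟩ := exists_between hE
    rw [hdens] at hδ
    have hfreq := frequently_lt_of_lt_limsup (isCoboundedUnder_le_of_mem_Icc (avg_mem_Icc
      (fun n => by rcases hu n with h | h <;> simp [h])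
      (fun n => by rcases hu n with h | h <;> simp [h])) _) hδ
    obtain ⟨ε, hε, hinf⟩ := h.exists_infinite_lt_upperCorrelation u hu hδ0 hfreq
    refine ⟨ε, hε, hinf.mono fun d hd => ⟨hd.1, ?_⟩⟩
    rw [upperDensity_inter_shift_eq hu hneg hmem]
    exact hd.2.2
  · by_contra hD
    obtain ⟨u, hu, hneg, ⟨a, ha, hlim⟩, hsymm, hcorr⟩ :=
      exists_sequence_of_not_isStrongRecurrenceSet hD
    set E : Set ℕ := {n | u n = 1}
    have hmem : ∀ n : ℕ, n ∈ E ↔ u n = 1 := fun n => Iff.rfl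
    have hdens : upperDensity E = a := by
      rw [← hlim.limsup_eq]
      exact upperDensity_eq_limsup_avg (fun n hn => hn) fun n hn => (hu n).resolve_right hn
    obtain ⟨ε, hε, hinf⟩ := h E (hdens ▸ ha)
    have hev := hcorr.eventually (gt_mem_nhds hε)
    rw [eventually_inf_principal, eventually_cofinite] at hev
    refine hinf (hev.subset fun d hd hlt => ?_)
    have := hd.2
    rw [upperDensity_inter_shift_eq hu hneg hmem, hsymm] at this
    exact lt_asymm this (hlt hd.1)
  · have hIcc := avg_mem_Icc (h := fun n : ℕ => u n)
      (fun n => by rcases hu n with h | h <;> simp [h])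
      (fun n => by rcases hu n with h | h <;> simp [h])
    refine tendsto_order.2 ⟨fun b hb => Eventually.of_forall fun N => hb.trans_le (hIcc N).1,
      fun b hb => ?_⟩
    by_contra hnot
    have hfreq : ∃ᶠ N : ℕ in atTop,
        b / 2 < (1 / (N : ℝ)) * ∑ n ∈ Finset.Icc 1 N, u (n : ℤ) :=
      (not_eventually.1 hnot).mono fun N hN => by linarith [not_lt.1 hN]
    obtain ⟨ε, hε, hinf⟩ := h.exists_infinite_lt_upperCorrelation u hu (half_pos hb) hfreq
    have hev := hcorr.eventually (gt_mem_nhds hε)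
    rw [eventually_inf_principal, eventually_cofinite] at hev
    exact hinf (hev.subset fun d hd hlt => lt_asymm hd.2.1 (hlt hd.1))
  · by_contra hD
    obtain ⟨u, hu, -, ⟨a, ha, hlim⟩, -, hcorr⟩ := exists_sequence_of_not_isStrongRecurrenceSet hD
    exact ha.ne (tendsto_nhds_unique (h u hu hcorr) hlim)
end
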